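/- arXiv:2211.02326 — 9 statements merged into one kernel-verified Lean document; each statement's English description precedes it below -/
import Mathlib

section
/- Let Γ be a strongly regular graph with parameters (ν, k, λ, μ) such that k ≥ 1 and Γ is not complete (there exist two distinct non-adjacent vertices), and with μ ≤ k. Let s = (λ − μ − √((λ − μ)² + 4(k − μ)))/2 be its smallest eigenvalue (a negative real number). Then the clique number of Γ satisfies ω(Γ) ≤ 1 − k/s (an inequality of real numbers). -/
open SimpleGraph

/-- The independence (coclique) number of a graph:
the clique number of the complement graph. -/
noncomputable def cocliqueNum {V : Type*} (G : SimpleGraph V) : ℕ :=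
  Gᶜ.cliqueNum

open Matrix

namespace SimpleGraph

variable {V : Type*} [Fintype V] {Γ : SimpleGraph V} [DecidableRel Γ.Adj] {ν k l μ : ℕ}

theorem IsRegularOfDegree.adjMatrix_mulVec_one (h : Γ.IsRegularOfDegree k) :
    Γ.adjMatrix ℝ *ᵥ 1 = (k : ℝ) • 1 := by
  ext v
  simp [adjMatrix_mulVec_apply, h.degree_eq]

/-- The square of the adjacency matrix of a strongly regular graph, as an operator on vectors. -/
theorem IsSRGWith.adjMatrix_mulVec_mulVec (h : Γ.IsSRGWith ν k l μ) (x : V → ℝ) :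
    Γ.adjMatrix ℝ *ᵥ (Γ.adjMatrix ℝ *ᵥ x) =
      ((k : ℝ) - μ) • x + ((l : ℝ) - μ) • (Γ.adjMatrix ℝ *ᵥ x) + (μ * ∑ v, x v) • 1 := by
  classical
  have hC : Γᶜ.adjMatrix ℝ = Matrix.of (fun _ _ => 1) - 1 - Γ.adjMatrix ℝ := by
    ext v w
    by_cases hvw : v = w <;> by_cases hadj : Γ.Adj v w <;>
      simp_all [adjMatrix_apply]
  rw [mulVec_mulVec, ← sq, h.matrix_eq, hC]
  simp only [← Nat.cast_smul_eq_nsmul ℝ]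
  ext v
  have hJ : (Matrix.of (fun _ _ => 1) *ᵥ x : V → ℝ) v = ∑ w, x w := by
    simp [mulVec, dotProduct]
  simp only [add_mulVec, sub_mulVec, smul_mulVec, one_mulVec, Pi.add_apply, Pi.sub_apply,
    Pi.smul_apply, hJ, smul_eq_mul, Pi.one_apply]
  ring

theorem IsSRGWith.mul_card_eq (h : Γ.IsSRGWith ν k l μ) [Nonempty V] :
    (μ : ℝ) * ν = (k : ℝ) ^ 2 - (l - μ) * k - (k - μ) := by
  obtain ⟨v⟩ := ‹Nonempty V›
  have key := congrFun (h.adjMatrix_mulVec_mulVec 1) v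
  simp only [h.regular.adjMatrix_mulVec_one, mulVec_smul] at key
  simp [h.card] at key
  linarith

theorem IsSRGWith.lt_degree (h : Γ.IsSRGWith ν k l μ) (hk : 1 ≤ k) [Nonempty V] : l < k := by
  obtain ⟨v⟩ := ‹Nonempty V›
  have hv : 0 < Γ.degree v := by rw [h.regular.degree_eq]; exact hk
  obtain ⟨w, hw⟩ := (Γ.degree_pos_iff_exists_adj v).1 hv
  rw [← h.of_adj v w hw, ← h.regular.degree_eq v]
  exact hw.card_commonNeighbors_lt_degree

theorem IsClique.indicator_dotProduct_adjMatrix_mulVec [DecidableEq V] {C : Finset V}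
    (hC : Γ.IsClique C) :
    (fun v => if v ∈ C then (1 : ℝ) else 0) ⬝ᵥ
      (Γ.adjMatrix ℝ *ᵥ fun v => if v ∈ C then (1 : ℝ) else 0) = C.card * (C.card - 1) := by
  have hd : ∀ v ∈ C, (Γ.adjMatrix ℝ *ᵥ fun v => if v ∈ C then (1 : ℝ) else 0) v =
      (C.card : ℝ) - 1 := by
    intro v hv
    have hN : Γ.neighborFinset v ∩ C = C.erase v := by
      ext w
      simp only [Finset.mem_inter, mem_neighborFinset, Finset.mem_erase]
      exact ⟨fun hw => ⟨hw.1.ne', hw.2⟩, fun hw => ⟨hC hv hw.2 hw.1.symm, hw.2⟩⟩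
    rw [adjMatrix_mulVec_apply, Finset.sum_ite_mem, hN]
    simp [Finset.card_erase_of_mem hv, Nat.cast_sub (Finset.card_pos.2 ⟨v, hv⟩)]
  simp only [dotProduct, ite_mul, one_mul, zero_mul, Finset.sum_ite_mem, Finset.univ_inter]
  rw [Finset.sum_congr rfl hd, Finset.sum_const, nsmul_eq_mul]

/-- The sum of squares `∑ v, ((A - r) x - t) v ^ 2`, for `x` the indicator vector of a clique,
is nonnegative. -/
theorem IsSRGWith.clique_quadratic_nonneg (h : Γ.IsSRGWith ν k l μ) {C : Finset V}
    (hC : Γ.IsClique C) (r t : ℝ) :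
    0 ≤ ((k : ℝ) - μ) * C.card + (l - μ) * (C.card * (C.card - 1)) + μ * C.card ^ 2
      - 2 * r * (C.card * (C.card - 1)) + r ^ 2 * C.card
      - 2 * t * (k - r) * C.card + t ^ 2 * ν := by
  classical
  set x : V → ℝ := fun v => if v ∈ C then 1 else 0 with hx
  set d := Γ.adjMatrix ℝ *ᵥ x with hd
  have hxd : x ⬝ᵥ d = C.card * (C.card - 1) := hC.indicator_dotProduct_adjMatrix_mulVec
  have hxx : x ⬝ᵥ x = C.card := by simp [dotProduct, hx]
  have hx1 : x ⬝ᵥ 1 = C.card := by simp [dotProduct, hx]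
  have hsum : ∑ v, x v = C.card := by simp [hx]
  have hsymm (y z : V → ℝ) : (Γ.adjMatrix ℝ *ᵥ y) ⬝ᵥ z = y ⬝ᵥ (Γ.adjMatrix ℝ *ᵥ z) := by
    rw [dotProduct_mulVec, ← mulVec_transpose, transpose_adjMatrix]
  have hd1 : d ⬝ᵥ 1 = k * C.card := by
    rw [hd, hsymm, h.regular.adjMatrix_mulVec_one, dotProduct_smul, hx1, smul_eq_mul]
  have hdd : d ⬝ᵥ d = ((k : ℝ) - μ) * C.card + (l - μ) * (C.card * (C.card - 1))
      + μ * C.card ^ 2 := by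
    rw [show d ⬝ᵥ d = x ⬝ᵥ (Γ.adjMatrix ℝ *ᵥ d) from hsymm x d, hd, h.adjMatrix_mulVec_mulVec,
      ← hd, dotProduct_add, dotProduct_add, dotProduct_smul, dotProduct_smul, dotProduct_smul,
      hxx, hxd, hx1, hsum]
    simp only [smul_eq_mul]
    ring
  have h11 : (1 : V → ℝ) ⬝ᵥ 1 = ν := by simp [dotProduct, h.card]
  have hdx : d ⬝ᵥ x = x ⬝ᵥ d := dotProduct_comm _ _
  have h1x : (1 : V → ℝ) ⬝ᵥ x = x ⬝ᵥ 1 := dotProduct_comm _ _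
  have h1d : (1 : V → ℝ) ⬝ᵥ d = d ⬝ᵥ 1 := dotProduct_comm _ _
  have hnn : 0 ≤ (d - r • x - t • 1) ⬝ᵥ (d - r • x - t • 1) :=
    Finset.sum_nonneg fun v _ => mul_self_nonneg _
  simp only [sub_dotProduct, dotProduct_sub, smul_dotProduct, dotProduct_smul, smul_eq_mul,
    h1x, h1d, hdx, hdd, hxd, hxx, hx1, hd1, h11] at hnn
  linarith

/-- The Delsarte bound in terms of the two roots `r`, `s` of `X ^ 2 - (l - μ) X - (k - μ)`. -/
theorem IsSRGWith.card_clique_mul_le (h : Γ.IsSRGWith ν k l μ) {C : Finset V}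
    (hC : Γ.IsClique C) [Nonempty V] {r s : ℝ} (hs : s < 0) (hr : 0 ≤ r) (hadd : r + s = l - μ)
    (hmul : r * s = μ - k) : C.card * -s ≤ k - s := by
  obtain hc | hc := C.card.eq_zero_or_pos
  · rw [hc]
    have := (k : ℕ).cast_nonneg (α := ℝ)
    simp only [Nat.cast_zero, zero_mul]
    linarith
  have hc' : (0 : ℝ) < C.card := by exact_mod_cast hc
  have hks : 0 < (k : ℝ) - s := by
    have := (k : ℕ).cast_nonneg (α := ℝ)
    linarith
  have hν : (μ : ℝ) * ν = (k - r) * (k - s) := by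
    rw [h.mul_card_eq, ← hadd]
    linear_combination -hmul
  have hq := h.clique_quadratic_nonneg hC r (μ * C.card / (k - s))
  have ht : (μ * C.card / (k - s)) ^ 2 * (ν : ℝ) =
      μ * C.card / (k - s) * (k - r) * C.card := by
    field_simp
    linear_combination (μ : ℝ) * hν
  rw [ht, ← hadd, show (k : ℝ) - μ = -(r * s) by linarith] at hq
  have hmain : 0 ≤ (C.card : ℝ) * (r - s) * (μ * C.card - (k - s) * (C.card - 1 - r)) := by
    have := mul_nonneg hq hks.le
    field_simp at this
    linarith
  have h1 := nonneg_of_mul_nonneg_right hmain (mul_pos hc' (by linarith))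
  rw [show (μ : ℝ) = k + r * s by linarith] at h1
  have h2 : 0 ≤ (1 + r) * (k - s - C.card * -s) := by linarith
  have h3 := nonneg_of_mul_nonneg_right h2 (by linarith)
  linarith

end SimpleGraph

/-- **Delsarte bound**: for a strongly regular graph `Γ` with parameters `(ν, k, l, μ)`,
`k ≥ 1`, not complete, and `μ ≤ k`, with smallest eigenvalue
`s = (l − μ − √((l − μ)² + 4(k − μ)))/2`, the clique number satisfies `ω(Γ) ≤ 1 − k/s`. -/
theorem delsarte_bound {V : Type*} [Fintype V] (Γ : SimpleGraph V) [DecidableRel Γ.Adj]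
    (ν k l μ : ℕ) (hsrg : Γ.IsSRGWith ν k l μ)
    (hk : 1 ≤ k) (hnc : ∃ u v : V, u ≠ v ∧ ¬Γ.Adj u v) (hμ : μ ≤ k)
    (s : ℝ)
    (hs : s = ((l : ℝ) - μ - Real.sqrt (((l : ℝ) - μ) ^ 2 + 4 * ((k : ℝ) - μ))) / 2) :
    (Γ.cliqueNum : ℝ) ≤ 1 - k / s := by
  classical
  obtain ⟨v, -⟩ := hnc
  have : Nonempty V := ⟨v⟩
  have hl : (l : ℝ) < k := by exact_mod_cast hsrg.lt_degree hk
  have hμ' : (μ : ℝ) ≤ k := by exact_mod_cast hμ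
  set q := Real.sqrt (((l : ℝ) - μ) ^ 2 + 4 * ((k : ℝ) - μ)) with hq
  have hq2 : q ^ 2 = ((l : ℝ) - μ) ^ 2 + 4 * ((k : ℝ) - μ) := Real.sq_sqrt (by nlinarith)
  have hq0 : 0 ≤ q := Real.sqrt_nonneg _
  have hle : |(l : ℝ) - μ| ≤ q := Real.abs_le_sqrt (by linarith)
  obtain ⟨hle₁, hle₂⟩ := abs_le.1 hle
  have hs0 : s < 0 := by
    by_contra! hcon
    have hql : q = l - μ := by linarith
    rw [hql] at hq2
    linarith
  obtain ⟨C, hC⟩ := Γ.exists_isNClique_cliqueNum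
  have hb := hsrg.card_clique_mul_le hC.isClique (r := ((l : ℝ) - μ + q) / 2) hs0 (by linarith)
    (by rw [hs]; ring) (by rw [hs]; linear_combination -hq2 / 4)
  rw [hC.card_eq, ← le_div_iff₀ (by linarith)] at hb
  refine hb.trans_eq ?_
  rw [div_neg, sub_div, div_self hs0.ne, neg_sub]
end

section
/- Let Γ be a strongly regular graph with parameters (ν, k, λ, μ) such that k ≥ 1 and Γ is not complete (there exist two distinct non-adjacent vertices), and with μ ≤ k. Let s = (λ − μ − √((λ − μ)² + 4(k − μ)))/2 be its smallest eigenvalue (a negative real number). Then the independence (coclique) number of Γ satisfies α(Γ) ≤ ν·s/(s − k) (an inequality of real numbers). -/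
open SimpleGraph

/-- The adjacency matrix `A` of a strongly regular graph satisfies
`(A - s)² = (l - μ - 2s)(A - s) + μJ` for every root `s` of `x² = (l - μ)x + (k - μ)`. -/
theorem SimpleGraph.IsSRGWith.adjMatrix_sub_smul_one_mul_self {V : Type*} [Fintype V]
    [DecidableEq V] {Γ : SimpleGraph V} [DecidableRel Γ.Adj] {ν k l μ : ℕ}
    (h : Γ.IsSRGWith ν k l μ) {s : ℝ} (hs : s ^ 2 = ((l : ℝ) - μ) * s + (k - μ)) :
    (Γ.adjMatrix ℝ - s • 1) * (Γ.adjMatrix ℝ - s • 1) =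
      ((l : ℝ) - μ - 2 * s) • (Γ.adjMatrix ℝ - s • 1) + (μ : ℝ) • Matrix.of fun _ _ => 1 := by
  have hA := h.matrix_eq (α := ℝ)
  have hexp : (Γ.adjMatrix ℝ - s • 1) * (Γ.adjMatrix ℝ - s • 1) =
      Γ.adjMatrix ℝ ^ 2 - (2 * s) • Γ.adjMatrix ℝ + s ^ 2 • 1 := by
    simp only [sub_mul, mul_sub, smul_mul_assoc, mul_smul_comm, one_mul, mul_one, pow_two]
    module
  rw [hexp, hA, hs]
  ext v w
  simp only [Matrix.add_apply, Matrix.sub_apply, Matrix.smul_apply, Matrix.one_apply,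
    adjMatrix_apply, compl_adj, Matrix.of_apply, smul_eq_mul]
  obtain rfl | hvw := eq_or_ne v w
  · simp only [SimpleGraph.irrefl, if_true, if_false, ne_eq, not_true_eq_false, false_and,
      nsmul_eq_mul]
    linear_combination -2 * hs
  · by_cases hadj : Γ.Adj v w
    · simp [hvw, hadj]
      ring
    · simp [hvw, hadj]

/-- On vectors with zero coordinate sum, the quadratic form of the adjacency matrix of a strongly
regular graph is bounded below by its smallest eigenvalue. -/
theorem SimpleGraph.IsSRGWith.dotProduct_adjMatrix_sub_smul_one_mulVec_nonneg {V : Type*}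
    [Fintype V] [DecidableEq V] {Γ : SimpleGraph V} [DecidableRel Γ.Adj] {ν k l μ : ℕ}
    (h : Γ.IsSRGWith ν k l μ) {s : ℝ} (hs : s ^ 2 = ((l : ℝ) - μ) * s + (k - μ))
    (hpos : 0 < (l : ℝ) - μ - 2 * s) {y : V → ℝ} (hy : ∑ v, y v = 0) :
    0 ≤ dotProduct y ((Γ.adjMatrix ℝ - s • 1).mulVec y) := by
  set B := Γ.adjMatrix ℝ - s • 1 with hB
  have hsymm : B.transpose = B := by simp [hB]
  have hJ : (Matrix.of fun _ _ : V => (1 : ℝ)).mulVec y = 0 := by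
    ext v
    simpa [Matrix.mulVec, dotProduct] using hy
  have key : dotProduct (B.mulVec y) (B.mulVec y) =
      ((l : ℝ) - μ - 2 * s) * dotProduct y (B.mulVec y) := by
    conv_lhs => rw [Matrix.dotProduct_mulVec, Matrix.vecMul_mulVec, hsymm,
      h.adjMatrix_sub_smul_one_mul_self hs, ← hB, ← Matrix.dotProduct_mulVec, Matrix.add_mulVec,
      Matrix.smul_mulVec, Matrix.smul_mulVec, hJ, smul_zero, add_zero, dotProduct_smul, smul_eq_mul]
  have hnonneg : 0 ≤ dotProduct (B.mulVec y) (B.mulVec y) :=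
    Finset.sum_nonneg fun v _ => mul_self_nonneg _
  rw [key] at hnonneg
  exact nonneg_of_mul_nonneg_right hnonneg hpos

/-- The ratio bound for a nonempty independent set `S` of a strongly regular graph. -/
theorem SimpleGraph.IsSRGWith.card_mul_sub_le_of_isIndepSet {V : Type*} [Fintype V]
    {Γ : SimpleGraph V} [DecidableRel Γ.Adj] {ν k l μ : ℕ} (h : Γ.IsSRGWith ν k l μ) {s : ℝ}
    (hs : s ^ 2 = ((l : ℝ) - μ) * s + (k - μ)) (hpos : 0 < (l : ℝ) - μ - 2 * s)
    {S : Finset V} (hS : Γ.IsIndepSet S) (hne : S.Nonempty) :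
    (S.card : ℝ) * (k - s) ≤ ν * -s := by
  classical
  set B := Γ.adjMatrix ℝ - s • 1 with hB
  set x : V → ℝ := fun v => if v ∈ S then 1 else 0 with hx
  set e : V → ℝ := fun _ => 1 with he
  have hν : (0 : ℝ) < ν := by
    have : Nonempty V := ⟨hne.choose⟩
    rw [← h.card]
    exact_mod_cast Fintype.card_pos
  have hc : (0 : ℝ) < S.card := by exact_mod_cast hne.card_pos
  have hex : dotProduct e x = S.card := by simp [he, hx, dotProduct]
  have hxe : dotProduct x e = S.card := by rw [dotProduct_comm, hex]
  have hee : dotProduct e e = ν := by simp [he, dotProduct, h.card]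
  have hBe : B.mulVec e = ((k : ℝ) - s) • e := by
    ext v
    simp [hB, he, Matrix.sub_mulVec, Matrix.smul_mulVec, h.regular.degree_eq v]
  have heB : dotProduct e (B.mulVec x) = (k - s) * S.card := by
    have hsymm : B.transpose = B := by simp [hB]
    rw [Matrix.dotProduct_mulVec, ← Matrix.mulVec_transpose, hsymm, hBe, smul_dotProduct, hex,
      smul_eq_mul]
  have hxB : dotProduct x (B.mulVec x) = -s * S.card := by
    have hxA : dotProduct x ((Γ.adjMatrix ℝ).mulVec x) = 0 := by
      refine Finset.sum_eq_zero fun v _ => ?_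
      rw [adjMatrix_mulVec_apply]
      by_cases hv : v ∈ S
      · rw [Finset.sum_eq_zero, mul_zero]
        intro w hw
        have hvw : Γ.Adj v w := by simpa using hw
        exact if_neg fun hwS => hS hv hwS hvw.ne hvw
      · simp [hx, hv]
    have hxx : dotProduct x x = S.card := by simp [hx, dotProduct]
    simp [hB, Matrix.sub_mulVec, Matrix.smul_mulVec, hxA, hxx]
  have hy : ∑ v, ((ν : ℝ) • x - (S.card : ℝ) • e) v = 0 := by
    rw [← one_dotProduct]
    change dotProduct e _ = 0
    rw [dotProduct_sub, dotProduct_smul, dotProduct_smul, hex, hee]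
    simp [mul_comm]
  have key := h.dotProduct_adjMatrix_sub_smul_one_mulVec_nonneg hs hpos hy
  rw [← hB] at key
  simp only [Matrix.mulVec_sub, Matrix.mulVec_smul, hBe, dotProduct_sub, sub_dotProduct,
    dotProduct_smul, smul_dotProduct, heB, hxB, hxe, hee, smul_eq_mul] at key
  have hfac : 0 ≤ (ν * S.card : ℝ) * (ν * -s - S.card * (k - s)) := by
    convert key using 1
    ring
  exact sub_nonneg.mp (nonneg_of_mul_nonneg_right hfac (mul_pos hν hc))

/-- **Hoffman bound**: for a strongly regular graph `Γ` with parameters `(ν, k, l, μ)`,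
`k ≥ 1`, not complete, and `μ ≤ k`, with smallest eigenvalue
`s = (l − μ − √((l − μ)² + 4(k − μ)))/2`, the independence number satisfies
`α(Γ) ≤ ν·s/(s − k)`. -/
theorem hoffman_bound {V : Type*} [Fintype V] (Γ : SimpleGraph V) [DecidableRel Γ.Adj]
    (ν k l μ : ℕ) (hsrg : Γ.IsSRGWith ν k l μ)
    (hk : 1 ≤ k) (hnc : ∃ u v : V, u ≠ v ∧ ¬Γ.Adj u v) (hμ : μ ≤ k)
    (s : ℝ)
    (hs : s = ((l : ℝ) - μ - Real.sqrt (((l : ℝ) - μ) ^ 2 + 4 * ((k : ℝ) - μ))) / 2) :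
    (cocliqueNum Γ : ℝ) ≤ ν * s / (s - k) := by
  classical
  obtain ⟨u, -, -, -⟩ := hnc
  have hlk : l < k := by
    obtain ⟨w, hw⟩ : ∃ w, Γ.Adj u w := by
      rw [← degree_pos_iff_exists_adj, hsrg.regular.degree_eq u]
      exact hk
    rw [← hsrg.of_adj u w hw, ← hsrg.regular.degree_eq u]
    convert hw.card_commonNeighbors_lt_degree
  have hμ' : (μ : ℝ) ≤ k := by exact_mod_cast hμ
  have hlk' : (l : ℝ) < k := by exact_mod_cast hlk
  have hk' : (1 : ℝ) ≤ k := by exact_mod_cast hk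
  have hD : 0 < ((l : ℝ) - μ) ^ 2 + 4 * (k - μ) := by
    obtain hlt | heq := hμ'.lt_or_eq
    · nlinarith [sq_nonneg ((l : ℝ) - μ)]
    · rw [heq, sub_self, mul_zero, add_zero]
      exact sq_pos_of_neg (by linarith)
  have hsqrt := Real.sqrt_pos.mpr hD
  have hsq := Real.sq_sqrt hD.le
  have habs : (l : ℝ) - μ ≤ √(((l : ℝ) - μ) ^ 2 + 4 * (k - μ)) :=
    Real.le_sqrt_of_sq_le (by linarith)
  have hroot : s ^ 2 = ((l : ℝ) - μ) * s + (k - μ) := by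
    rw [hs]
    linear_combination hsq / 4
  have hpos : 0 < (l : ℝ) - μ - 2 * s := by linarith
  have hs0 : s ≤ 0 := by linarith
  obtain ⟨S, hS⟩ := Γᶜ.exists_isNClique_cliqueNum
  rw [cocliqueNum, ← neg_div_neg_eq, le_div_iff₀ (by linarith), neg_sub, ← mul_neg, ← hS.card_eq]
  obtain rfl | hne := S.eq_empty_or_nonempty
  · simpa using mul_nonpos_of_nonneg_of_nonpos ν.cast_nonneg hs0
  · exact hsrg.card_mul_sub_le_of_isIndepSet hroot hpos (by simpa using hS.isClique) hne
end

section
/- Let Γ be a strongly regular graph with parameters (ν, k, λ, μ) such that k ≥ 1 and Γ is not complete (there exist two distinct non-adjacent vertices), and with μ ≤ k. Then the product of the clique number and the independence number of Γ satisfies ω(Γ)·α(Γ) ≤ ν. -/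
open SimpleGraph

namespace SimpleGraph

variable {V : Type*} [Fintype V] [DecidableEq V] {G : SimpleGraph V} [DecidableRel G.Adj]
  {n k l m : ℕ}

omit [DecidableEq V] in
theorem IsRegularOfDegree.sum_adjMatrix_apply (h : G.IsRegularOfDegree k) (v : V) :
    ∑ u, G.adjMatrix ℝ v u = k := by
  rw [← h v, ← card_neighborFinset_eq_degree, neighborFinset_eq_filter]
  simp [adjMatrix_apply]

/-- Counting the pairs of vertices of `T` by their common neighbours. -/
theorem IsSRGWith.sum_sq_sum_adjMatrix (h : G.IsSRGWith n k l m) (T : Finset V) :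
    ∑ v, (∑ u ∈ T, G.adjMatrix ℝ v u) ^ 2 =
      k * T.card + l * (∑ v ∈ T, ∑ u ∈ T, G.adjMatrix ℝ v u) +
        m * ((T.card : ℝ) ^ 2 - T.card - ∑ v ∈ T, ∑ u ∈ T, G.adjMatrix ℝ v u) := by
  have entry (u w : V) : ∑ v, G.adjMatrix ℝ v u * G.adjMatrix ℝ v w =
      k * (if u = w then 1 else 0) + l * G.adjMatrix ℝ u w +
        m * (1 - (if u = w then 1 else 0) - G.adjMatrix ℝ u w) := by
    have hA := congrFun (congrFun (h.matrix_eq (α := ℝ)) u) w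
    rw [sq, Matrix.mul_apply] at hA
    simp only [Matrix.add_apply, Matrix.smul_apply, Matrix.one_apply] at hA
    have hsymm (v : V) : G.adjMatrix ℝ v u = G.adjMatrix ℝ u v := by
      simp [adjMatrix_apply, G.adj_comm]
    simp only [hsymm, hA]
    by_cases huw : u = w
    · subst huw; simp
    · by_cases hadj : G.Adj u w <;> simp [huw, hadj]
  calc ∑ v, (∑ u ∈ T, G.adjMatrix ℝ v u) ^ 2
      = ∑ u ∈ T, ∑ w ∈ T, ∑ v, G.adjMatrix ℝ v u * G.adjMatrix ℝ v w := by
        simp only [sq, Finset.sum_mul_sum]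
        rw [Finset.sum_comm]
        exact Finset.sum_congr rfl fun u _ => Finset.sum_comm
    _ = _ := by
        simp only [entry, Finset.sum_add_distrib, ← Finset.mul_sum, Finset.sum_sub_distrib]
        simp [sq]

/-- The Cauchy–Schwarz inequality for the vector `A x - θ x`, where `x` is the indicator vector
of `T` and `A` the adjacency matrix. -/
theorem IsSRGWith.sq_le_card_mul (h : G.IsSRGWith n k l m) (T : Finset V) (θ : ℝ) :
    ((k - θ) * T.card) ^ 2 ≤
      n * (k * T.card + l * (∑ v ∈ T, ∑ u ∈ T, G.adjMatrix ℝ v u) +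
        m * ((T.card : ℝ) ^ 2 - T.card - ∑ v ∈ T, ∑ u ∈ T, G.adjMatrix ℝ v u) -
        2 * θ * (∑ v ∈ T, ∑ u ∈ T, G.adjMatrix ℝ v u) + θ ^ 2 * T.card) := by
  have hsum : ∑ v, ((∑ u ∈ T, G.adjMatrix ℝ v u) - θ * if v ∈ T then 1 else 0) =
      (k - θ) * T.card := by
    have hA : ∑ v, ∑ u ∈ T, G.adjMatrix ℝ v u = k * T.card := by
      calc ∑ v, ∑ u ∈ T, G.adjMatrix ℝ v u = ∑ u ∈ T, ∑ v, G.adjMatrix ℝ v u := Finset.sum_comm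
        _ = ∑ u ∈ T, ∑ v, G.adjMatrix ℝ u v := by simp only [adjMatrix_apply, G.adj_comm]
        _ = k * T.card := by simp only [h.regular.sum_adjMatrix_apply]; simp [mul_comm]
    rw [Finset.sum_sub_distrib, hA, ← Finset.mul_sum]
    simp
    ring
  have hsq : ∑ v, ((∑ u ∈ T, G.adjMatrix ℝ v u) - θ * if v ∈ T then 1 else 0) ^ 2 =
      ∑ v, (∑ u ∈ T, G.adjMatrix ℝ v u) ^ 2 -
        2 * θ * (∑ v ∈ T, ∑ u ∈ T, G.adjMatrix ℝ v u) + θ ^ 2 * T.card := by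
    have expand (v : V) : ((∑ u ∈ T, G.adjMatrix ℝ v u) - θ * if v ∈ T then 1 else 0) ^ 2 =
        (∑ u ∈ T, G.adjMatrix ℝ v u) ^ 2 -
          2 * θ * (if v ∈ T then ∑ u ∈ T, G.adjMatrix ℝ v u else 0) +
          θ ^ 2 * (if v ∈ T then 1 else 0) := by
      split_ifs <;> ring
    simp only [expand, Finset.sum_add_distrib, Finset.sum_sub_distrib, ← Finset.mul_sum]
    simp
  have hcs := sq_sum_le_card_mul_sum_sq (s := Finset.univ)
    (f := fun v => (∑ u ∈ T, G.adjMatrix ℝ v u) - θ * if v ∈ T then 1 else 0)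
  rwa [hsum, hsq, h.sum_sq_sum_adjMatrix, Finset.card_univ, h.card] at hcs

omit [Fintype V] in
theorem IsClique.sum_adjMatrix {T : Finset V} (hT : G.IsClique (T : Set V)) :
    ∑ v ∈ T, ∑ u ∈ T, G.adjMatrix ℝ v u = (T.card : ℝ) * (T.card - 1) := by
  have entry : ∀ v ∈ T, ∑ u ∈ T, G.adjMatrix ℝ v u = T.card - 1 := fun v hv => by
    have : ∀ u ∈ T, G.adjMatrix ℝ v u = 1 - if v = u then 1 else 0 := fun u hu => by
      by_cases huv : v = u
      · simp [huv]
      · simp [huv, hT hv hu huv]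
    rw [Finset.sum_congr rfl this]
    simp [hv]
  rw [Finset.sum_congr rfl entry]
  simp [mul_sub]

omit [Fintype V] in
theorem IsClique.sum_adjMatrix_eq_zero {T : Finset V} (hT : Gᶜ.IsClique (T : Set V)) :
    ∑ v ∈ T, ∑ u ∈ T, G.adjMatrix ℝ v u = 0 := by
  refine Finset.sum_eq_zero fun v hv => Finset.sum_eq_zero fun u hu => ?_
  by_cases huv : v = u
  · simp [huv]
  · simp [((compl_adj ..).1 (hT hv hu huv)).2]

/-- The parameters of a strongly regular graph satisfy `k ^ 2 = k + l k + m (n - 1 - k)`. -/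
theorem IsSRGWith.sq_degree_eq (h : G.IsSRGWith n k l m) (hn : 0 < n) :
    (k : ℝ) ^ 2 = k + l * k + m * (n - 1 - k) := by
  have hsum := h.sum_sq_sum_adjMatrix Finset.univ
  simp only [h.regular.sum_adjMatrix_apply, Finset.sum_const, Finset.card_univ, h.card, nsmul_eq_mul] at hsum
  have hn' : (n : ℝ) ≠ 0 := by positivity
  apply mul_left_cancel₀ hn'
  linear_combination hsum

end SimpleGraph

/-- **Clique–coclique bound** for strongly regular graphs: if `Γ` is strongly regular with
parameters `(ν, k, l, μ)`, `k ≥ 1`, not complete, and `μ ≤ k`, then `ω(Γ)·α(Γ) ≤ ν`. -/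
theorem clique_coclique_bound {V : Type*} [Fintype V] (Γ : SimpleGraph V) [DecidableRel Γ.Adj]
    (ν k l μ : ℕ) (hsrg : Γ.IsSRGWith ν k l μ)
    (hk : 1 ≤ k) (hnc : ∃ u v : V, u ≠ v ∧ ¬Γ.Adj u v) (hμ : μ ≤ k) :
    Γ.cliqueNum * cocliqueNum Γ ≤ ν := by
  classical
  obtain ⟨u, -⟩ := hnc
  have hkν : k < ν := by
    rw [← hsrg.regular u, ← hsrg.card]
    exact Γ.degree_lt_card_verts u
  have hlk : l < k := by
    obtain ⟨w, hw⟩ := (Γ.degree_pos_iff_exists_adj u).1 (by rw [hsrg.regular u]; exact hk)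
    rw [← hsrg.of_adj u w hw, ← hsrg.regular u]
    exact hw.card_commonNeighbors_lt_degree
  obtain ⟨C, hC⟩ := Γ.exists_isNClique_cliqueNum
  obtain ⟨S, hS⟩ := Γᶜ.exists_isNClique_cliqueNum
  have hparam := hsrg.sq_degree_eq (by lia)
  have hclique := hsrg.sq_le_card_mul C
  have hcoclique := hsrg.sq_le_card_mul S
  rw [hC.isClique.sum_adjMatrix, hC.card_eq] at hclique
  rw [hS.isClique.sum_adjMatrix_eq_zero, hS.card_eq] at hcoclique
  rw [cocliqueNum]
  generalize Γ.cliqueNum = c at *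
  generalize Γᶜ.cliqueNum = a at *
  have hkν' : (k : ℝ) < ν := by exact_mod_cast hkν
  have hlk' : (l : ℝ) < k := by exact_mod_cast hlk
  have hμ' : (μ : ℝ) ≤ k := by exact_mod_cast hμ
  have hk' : (1 : ℝ) ≤ k := by exact_mod_cast hk
  -- The restricted eigenvalues `s ≤ 0 ≤ r` of `Γ`.
  obtain ⟨r, s, hr, hs, hrs, hadd, hmul⟩ : ∃ r s : ℝ, 0 ≤ r ∧ s ≤ 0 ∧ s < r ∧
      r + s = l - μ ∧ r * s = μ - k := by
    have hdisc : 0 < ((l : ℝ) - μ) ^ 2 + 4 * (k - μ) := by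
      rcases hμ'.lt_or_eq with hlt | heq
      · nlinarith [sq_nonneg ((l : ℝ) - μ)]
      · nlinarith [mul_pos (sub_pos.2 hlk') (sub_pos.2 hlk')]
    have hd := Real.sq_sqrt hdisc.le
    have hpos := Real.sqrt_pos.2 hdisc
    have habs : |(l : ℝ) - μ| ≤ √(((l : ℝ) - μ) ^ 2 + 4 * (k - μ)) :=
      Real.abs_le_sqrt (by linarith)
    obtain ⟨h₁, h₂⟩ := abs_le.1 habs
    refine ⟨(l - μ + √(((l : ℝ) - μ) ^ 2 + 4 * (k - μ))) / 2,
      (l - μ - √(((l : ℝ) - μ) ^ 2 + 4 * (k - μ))) / 2, ?_, ?_, ?_, ?_, ?_⟩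
    · linarith
    · linarith
    · linarith
    · ring
    · linear_combination -hd / 4
  have hl : (l : ℝ) = r + s + μ := by linarith
  have hμν : (k - s) * (k - r) = (μ : ℝ) * ν := by
    linear_combination hparam - k * hadd + hmul
  have hν : (0 : ℝ) < ν := by linarith
  have hcoclique' : (a : ℝ) * (k - s) ≤ -s * ν := by
    rcases (Nat.cast_nonneg (α := ℝ) a).eq_or_lt with h0 | hpos
    · rw [← h0]; nlinarith
    · have key : (a : ℝ) * (r - s) * (a * (k - s)) ≤ a * (r - s) * (-s * ν) := by
        have := hcoclique s
        linear_combination this - (a : ℝ) ^ 2 * hμν + a * ν * hmul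
      exact le_of_mul_le_mul_left key (mul_pos hpos (sub_pos.2 hrs))
  have hclique' : (c : ℝ) * (ν - k + r) ≤ ν * (r + 1) := by
    rcases (Nat.cast_nonneg (α := ℝ) c).eq_or_lt with h0 | hpos
    · rw [← h0]; nlinarith
    · have key : (c : ℝ) * (r - s) * (c * (ν - k + r)) ≤ c * (r - s) * (ν * (r + 1)) := by
        have := hclique r
        rw [hl] at this
        linear_combination this - (c : ℝ) ^ 2 * hμν + c * ν * hmul
      exact le_of_mul_le_mul_left key (mul_pos hpos (sub_pos.2 hrs))
  have hprod : (k - s) * (ν - k + r) = ν * (r + 1) * -s := by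
    linear_combination -hμν + ν * hmul
  have hpos : 0 < (k - s) * (ν - k + r) := mul_pos (by linarith) (by linarith)
  have hfinal : (k - s) * (ν - k + r) * ((c : ℝ) * a) ≤ (k - s) * (ν - k + r) * ν := by
    calc (k - s) * (ν - k + r) * ((c : ℝ) * a)
        = (c * (ν - k + r)) * (a * (k - s)) := by ring
      _ ≤ (ν * (r + 1)) * (-s * ν) :=
        mul_le_mul hclique' hcoclique' (mul_nonneg a.cast_nonneg (by linarith)) (by positivity)
      _ = (k - s) * (ν - k + r) * ν := by rw [hprod]; ring
  exact_mod_cast le_of_mul_le_mul_left hfinal hpos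
end

section
/- Let Γ be a simple graph on a finite vertex set V that is vertex-transitive, i.e., the automorphism group of Γ acts transitively on V. Then ω(Γ)·α(Γ) ≤ |V|, where ω(Γ) is the clique number and α(Γ) is the independence number of Γ. -/
open SimpleGraph

/-- For a transitive action of a finite group, the number of group elements sending `a` to `b`
does not depend on `a` and `b`. -/
theorem card_smul_eq_const {G X : Type*} [Group G] [Fintype G] [MulAction G X] [DecidableEq X]
    [MulAction.IsPretransitive G X] (a b c d : X) :
    (Finset.univ.filter fun g : G => g • a = b).card =
      (Finset.univ.filter fun g : G => g • c = d).card := by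
  obtain ⟨h, rfl⟩ := MulAction.exists_smul_eq G c a
  obtain ⟨k, rfl⟩ := MulAction.exists_smul_eq G b d
  refine Finset.card_equiv ((Equiv.mulRight h).trans (Equiv.mulLeft k)) fun g => ?_
  simp [mul_smul]

/-- If a finite group acts transitively on `X` and every translate of `A` meets `B` in at most
one point, then `|A| * |B| ≤ |X|`. -/
theorem card_mul_card_le_of_smul_inter_subsingleton (G : Type*) {X : Type*} [Group G] [Finite G]
    [Fintype X] [MulAction G X] [MulAction.IsPretransitive G X] (A B : Finset X)
    (h : ∀ g : G, ∀ a ∈ A, ∀ a' ∈ A, g • a ∈ B → g • a' ∈ B → a = a') :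
    A.card * B.card ≤ Fintype.card X := by
  classical
  cases nonempty_fintype G
  obtain rfl | ⟨x, -⟩ := A.eq_empty_or_nonempty
  · simp
  set c := (Finset.univ.filter fun g : G => g • x = x).card
  have hc : 0 < c := Finset.card_pos.2 ⟨1, by simp⟩
  have hG : Fintype.card G = Fintype.card X * c := by
    rw [← Finset.card_univ, Finset.card_eq_sum_card_fiberwise (f := fun g : G => g • x)
      (t := Finset.univ) (by simp), Finset.sum_congr rfl fun y _ => card_smul_eq_const x y x x]
    simp [c]
  refine Nat.le_of_mul_le_mul_right ?_ hc
  calc A.card * B.card * c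
      = ∑ p ∈ A ×ˢ B, (Finset.univ.filter fun g : G => g • p.1 = p.2).card := by
        rw [Finset.sum_congr rfl fun p _ => card_smul_eq_const p.1 p.2 x x]
        simp [c]
    _ = ∑ g : G, ((A ×ˢ B).filter fun p => g • p.1 = p.2).card :=
        Finset.sum_card_bipartiteAbove_eq_sum_card_bipartiteBelow
          fun (p : X × X) (g : G) => g • p.1 = p.2
    _ ≤ ∑ _g : G, 1 := by
        refine Finset.sum_le_sum fun g _ => Finset.card_le_one.2 ?_
        rintro ⟨a, b⟩ hp ⟨a', b'⟩ hq
        simp only [Finset.mem_filter, Finset.mem_product] at hp hq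
        obtain ⟨⟨ha, hb⟩, rfl⟩ := hp
        obtain ⟨⟨ha', hb'⟩, rfl⟩ := hq
        rw [h g a ha a' ha' hb hb']
    _ = Fintype.card X * c := by simp [hG]

/-- **Clique–coclique bound for vertex-transitive graphs**: if the automorphism group of a
finite simple graph `Γ` acts transitively on its vertices, then `ω(Γ)·α(Γ) ≤ |V|`. -/
theorem clique_coclique_of_vertexTransitive {V : Type*} [Fintype V] (Γ : SimpleGraph V)
    (htrans : ∀ u v : V, ∃ e : Γ ≃g Γ, e u = v) :
    Γ.cliqueNum * cocliqueNum Γ ≤ Fintype.card V := by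
  obtain ⟨A, hA⟩ := Γ.exists_isNClique_cliqueNum
  obtain ⟨B, hB⟩ := Γᶜ.exists_isNClique_cliqueNum
  have : Finite (Γ ≃g Γ) := DFunLike.finite _
  let _ : MulAction (Γ ≃g Γ) V :=
    { smul := fun e v => e v, one_smul := fun _ => rfl, mul_smul := fun _ _ _ => rfl }
  have : MulAction.IsPretransitive (Γ ≃g Γ) V := ⟨htrans⟩
  rw [cocliqueNum, ← hA.card_eq, ← hB.card_eq]
  refine card_mul_card_le_of_smul_inter_subsingleton (Γ ≃g Γ) A B fun e a ha a' ha' hb hb' => ?_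
  by_contra hne
  exact (hB.isClique hb hb' (e.injective.ne hne)).2 (e.map_adj_iff.2 (hA.isClique ha ha' hne))
end

section
/- Let Γ be a strongly regular graph with parameters (ν, k, λ, μ) such that k ≥ 1 and Γ is not complete (there exist two distinct non-adjacent vertices), and with μ ≤ k. Let s = (λ − μ − √((λ − μ)² + 4(k − μ)))/2 be its smallest eigenvalue. Then Γ is non-separating (i.e., ω(Γ)·α(Γ) = ν) if and only if ω(Γ) = 1 − k/s and α(Γ) = ν·s/(s − k) (equalities of real numbers). -/
open SimpleGraph

namespace SimpleGraph.IsSRGWith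

open Matrix

variable {V : Type*} [Fintype V] {Γ : SimpleGraph V} [DecidableRel Γ.Adj] {n k l μ : ℕ}

theorem l_lt_k [Nonempty V] (h : Γ.IsSRGWith n k l μ) (hk : 1 ≤ k) : l < k := by
  classical
  obtain ⟨v⟩ := ‹Nonempty V›
  obtain ⟨w, hw⟩ : ∃ w, Γ.Adj v w :=
    (Γ.degree_pos_iff_exists_adj v).mp (by rw [h.regular v]; omega)
  have hlt := hw.card_commonNeighbors_lt_degree
  rwa [h.regular v, h.of_adj v w hw] at hlt

theorem adjMatrix_mulVec_mulVec_s4 [DecidableEq V] (h : Γ.IsSRGWith n k l μ) (x : V → ℝ) (v : V) :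
    (Γ.adjMatrix ℝ *ᵥ (Γ.adjMatrix ℝ *ᵥ x)) v =
      ((l : ℝ) - μ) * (Γ.adjMatrix ℝ *ᵥ x) v + ((k : ℝ) - μ) * x v + μ * ∑ w, x w := by
  have hJ : Γᶜ.adjMatrix ℝ = Matrix.of (fun _ _ => 1) - 1 - Γ.adjMatrix ℝ := by
    ext i j
    by_cases hij : i = j
    · subst hij
      simp
    · by_cases ha : Γ.Adj i j <;> simp [hij, ha]
  rw [mulVec_mulVec, ← pow_two, h.matrix_eq, hJ]
  have h1 : ((Matrix.of (fun _ _ => 1) : Matrix V V ℝ) *ᵥ x) v = ∑ w, x w := by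
    simp [mulVec, dotProduct]
  simp only [add_mulVec, sub_mulVec, smul_mulVec, one_mulVec, Pi.add_apply, Pi.sub_apply,
    Pi.smul_apply, h1]
  simp only [nsmul_eq_mul]
  ring

theorem sum_adjMatrix_mulVec (h : Γ.IsSRGWith n k l μ) (x : V → ℝ) :
    ∑ v, (Γ.adjMatrix ℝ *ᵥ x) v = k * ∑ v, x v := by
  have hc : ∀ w, ∑ v, Γ.adjMatrix ℝ v w = k := fun w => by
    have := h.regular w
    simp [adjMatrix_apply, Γ.adj_comm _ w, ← this, ← card_neighborFinset_eq_degree,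
      neighborFinset_eq_filter]
  simp only [mulVec, dotProduct]
  rw [Finset.sum_comm]
  simp only [← Finset.sum_mul, hc, Finset.mul_sum]

theorem sum_adjMatrix_mulVec_sq (h : Γ.IsSRGWith n k l μ) (x : V → ℝ) :
    ∑ v, (Γ.adjMatrix ℝ *ᵥ x) v ^ 2 =
      ((l : ℝ) - μ) * ∑ v, x v * (Γ.adjMatrix ℝ *ᵥ x) v + ((k : ℝ) - μ) * ∑ v, x v ^ 2 +
        μ * (∑ v, x v) ^ 2 := by
  classical
  have h1 : ∑ v, (Γ.adjMatrix ℝ *ᵥ x) v ^ 2 =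
      ∑ v, x v * (Γ.adjMatrix ℝ *ᵥ (Γ.adjMatrix ℝ *ᵥ x)) v := by
    change _ = x ⬝ᵥ (Γ.adjMatrix ℝ *ᵥ (Γ.adjMatrix ℝ *ᵥ x))
    rw [dotProduct_mulVec, ← mulVec_transpose, transpose_adjMatrix]
    simp [dotProduct, pow_two]
  rw [h1, pow_two (∑ v, x v), Finset.sum_mul, Finset.mul_sum, Finset.mul_sum, Finset.mul_sum,
    ← Finset.sum_add_distrib, ← Finset.sum_add_distrib]
  refine Finset.sum_congr rfl fun v _ => ?_
  rw [h.adjMatrix_mulVec_mulVec_s4]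
  ring

theorem mul_eq_of_roots [Nonempty V] (h : Γ.IsSRGWith n k l μ) {r s : ℝ}
    (hadd : r + s = (l : ℝ) - μ) (hmul : r * s = (μ : ℝ) - k) :
    ((k : ℝ) - r) * (k - s) = n * μ := by
  classical
  obtain ⟨v⟩ := ‹Nonempty V›
  have hA : Γ.adjMatrix ℝ *ᵥ (fun _ => 1) = fun _ => (k : ℝ) := by
    ext w
    simp [mulVec, dotProduct, adjMatrix_apply, ← h.regular w, ← card_neighborFinset_eq_degree,
      neighborFinset_eq_filter]
  have hA' : (Γ.adjMatrix ℝ *ᵥ (fun _ => (k : ℝ))) v = k * k := by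
    rw [show (fun _ : V => (k : ℝ)) = (k : ℝ) • fun _ => 1 by ext; simp, mulVec_smul, hA]
    simp
  have := h.adjMatrix_mulVec_mulVec_s4 (fun _ => 1) v
  rw [hA, hA'] at this
  simp only [Finset.sum_const, Finset.card_univ, h.card, nsmul_eq_mul] at this
  linear_combination this - k * hadd + hmul

/-- The quadratic form of `A - r - (k - r) / n • J` is semidefinite, with the sign of `s - r`,
when `r` and `s` are the two restricted eigenvalues. -/
theorem quadratic_form_nonneg [Nonempty V] (h : Γ.IsSRGWith n k l μ) {r s : ℝ}
    (hadd : r + s = (l : ℝ) - μ) (hmul : r * s = (μ : ℝ) - k) (x : V → ℝ) :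
    0 ≤ (s - r) * (n * ∑ v, x v * (Γ.adjMatrix ℝ *ᵥ x) v - r * n * ∑ v, x v ^ 2 -
      (k - r) * (∑ v, x v) ^ 2) := by
  have hn : 0 < (n : ℝ) := by
    rw [← h.card]
    exact_mod_cast Fintype.card_pos
  have hkrs := h.mul_eq_of_roots hadd hmul
  set c : ℝ := (k - r) * (∑ v, x v) / n with hc
  have hcn : c * n = (k - r) * (∑ v, x v) := by
    rw [hc]
    field_simp
  have hsq : 0 ≤ ∑ v, ((Γ.adjMatrix ℝ *ᵥ x) v - r * x v - c) ^ 2 :=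
    Finset.sum_nonneg fun _ _ => sq_nonneg _
  have hexp : ∑ v, ((Γ.adjMatrix ℝ *ᵥ x) v - r * x v - c) ^ 2 =
      ∑ v, (Γ.adjMatrix ℝ *ᵥ x) v ^ 2 - 2 * r * ∑ v, x v * (Γ.adjMatrix ℝ *ᵥ x) v +
        r ^ 2 * ∑ v, x v ^ 2 - 2 * c * ∑ v, (Γ.adjMatrix ℝ *ᵥ x) v + 2 * r * c * ∑ v, x v +
        n * c ^ 2 := by
    have hconst : n * c ^ 2 = ∑ _v : V, c ^ 2 := by simp [h.card]
    rw [hconst]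
    simp only [Finset.mul_sum, ← Finset.sum_add_distrib, ← Finset.sum_sub_distrib]
    exact Finset.sum_congr rfl fun v _ => by ring
  rw [hexp, h.sum_adjMatrix_mulVec_sq, h.sum_adjMatrix_mulVec] at hsq
  refine (mul_nonneg hn.le hsq).trans_eq ?_
  generalize ∑ v, x v * (Γ.adjMatrix ℝ *ᵥ x) v = e at *
  generalize ∑ v, x v ^ 2 = q at *
  generalize ∑ v, x v = y at *
  linear_combination (-n * e) * hadd + n * q * hmul - y ^ 2 * hkrs +
    (c * n + (k - r) * y - 2 * (k - r) * y) * hcn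

end SimpleGraph.IsSRGWith

namespace SimpleGraph

open Matrix

variable {V : Type*} [Fintype V] {Γ : SimpleGraph V} [DecidableRel Γ.Adj]

theorem IsClique.sum_indicator_mul_adjMatrix_mulVec {S : Finset V} (hS : Γ.IsClique S) :
    ∑ v, (S : Set V).indicator 1 v * (Γ.adjMatrix ℝ *ᵥ (S : Set V).indicator 1) v =
      (S.card : ℝ) * (S.card - 1) := by
  classical
  have h : ∀ v ∈ S, ∑ w ∈ S, Γ.adjMatrix ℝ v w = (S.card : ℝ) - 1 := fun v hv => by
    rw [← Finset.sum_erase_add _ _ hv, Finset.sum_congr rfl (g := fun _ => (1 : ℝ))]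
    · simp [Finset.card_erase_of_mem hv, Nat.cast_sub (Finset.card_pos.mpr ⟨v, hv⟩)]
    · intro w hw
      have := hS hv (Finset.mem_of_mem_erase hw) (Finset.ne_of_mem_erase hw).symm
      simp [adjMatrix_apply, this]
  simp only [mulVec, dotProduct, Set.indicator_apply, Pi.one_apply, Finset.mem_coe, mul_ite,
    mul_one, mul_zero, ite_mul, one_mul, zero_mul, Finset.sum_ite_mem, Finset.univ_inter]
  rw [Finset.sum_congr rfl h, Finset.sum_const, nsmul_eq_mul]

theorem IsIndepSet.sum_indicator_mul_adjMatrix_mulVec {S : Finset V} (hS : Γ.IsIndepSet S) :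
    ∑ v, (S : Set V).indicator 1 v * (Γ.adjMatrix ℝ *ᵥ (S : Set V).indicator 1) v = 0 := by
  classical
  simp only [mulVec, dotProduct, Set.indicator_apply, Pi.one_apply, Finset.mem_coe, mul_ite,
    mul_one, mul_zero, ite_mul, one_mul, zero_mul, Finset.sum_ite_mem, Finset.univ_inter]
  refine Finset.sum_eq_zero fun v hv => Finset.sum_eq_zero fun w hw => ?_
  have : ¬Γ.Adj v w := fun hvw => hS hv hw hvw.ne hvw
  simp [adjMatrix_apply, this]

theorem sum_indicator_one (S : Finset V) :
    ∑ v, (S : Set V).indicator (1 : V → ℝ) v = S.card := by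
  classical
  simp [Set.indicator_apply]

theorem sum_indicator_one_sq (S : Finset V) :
    ∑ v, (S : Set V).indicator (1 : V → ℝ) v ^ 2 = S.card := by
  classical
  simp [Set.indicator_apply]

/-- The Hoffman bound on independent sets of a strongly regular graph. -/
theorem IsSRGWith.card_mul_le_of_isIndepSet [Nonempty V] {n k l μ : ℕ}
    (h : Γ.IsSRGWith n k l μ) {r s : ℝ} (hadd : r + s = (l : ℝ) - μ)
    (hmul : r * s = (μ : ℝ) - k) (hrs : s < r) {S : Finset V} (hS : Γ.IsIndepSet S)
    (hne : S.Nonempty) : (S.card : ℝ) * (k - s) ≤ -(n * s) := by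
  have hc : 0 < (S.card : ℝ) := by exact_mod_cast hne.card_pos
  have hq := h.quadratic_form_nonneg (r := s) (s := r) (by linarith) (by linarith)
    ((S : Set V).indicator 1)
  rw [hS.sum_indicator_mul_adjMatrix_mulVec, sum_indicator_one, sum_indicator_one_sq] at hq
  have := nonneg_of_mul_nonneg_right hq (sub_pos.mpr hrs)
  have : 0 ≤ (S.card : ℝ) * (-(n * s) - S.card * (k - s)) := by linarith
  linarith [nonneg_of_mul_nonneg_right this hc]

/-- The Delsarte bound on cliques of a strongly regular graph. -/
theorem IsSRGWith.sub_le_card_mul_of_isClique [Nonempty V] {n k l μ : ℕ}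
    (h : Γ.IsSRGWith n k l μ) {r s : ℝ} (hadd : r + s = (l : ℝ) - μ)
    (hmul : r * s = (μ : ℝ) - k) (hr : 0 ≤ r) (hs : s < 0) {S : Finset V} (hS : Γ.IsClique S)
    (hne : S.Nonempty) : s - k ≤ (S.card : ℝ) * s := by
  have hc : 0 < (S.card : ℝ) := by exact_mod_cast hne.card_pos
  have hkn : (k : ℝ) < n := by
    obtain ⟨v⟩ := ‹Nonempty V›
    have := Γ.degree_lt_card_verts v
    rw [h.regular v, h.card] at this
    exact_mod_cast this
  have hkrs := h.mul_eq_of_roots hadd hmul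
  have hq := h.quadratic_form_nonneg hadd hmul ((S : Set V).indicator 1)
  rw [hS.sum_indicator_mul_adjMatrix_mulVec, sum_indicator_one, sum_indicator_one_sq] at hq
  have h1 : 0 ≤ ((r - s) * S.card) * (n * (1 + r) - S.card * (n - k + r)) := by linarith
  have h2 := nonneg_of_mul_nonneg_right h1 (mul_pos (by linarith) hc)
  have h3 : n * (1 + r) * s = (s - k) * (n - k + r) := by
    linear_combination n * hmul - hkrs
  have h4 : 0 ≤ (n - k + r) * (S.card * s - (s - k)) := by
    nlinarith [mul_nonneg h2 (neg_nonneg.mpr hs.le)]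
  linarith [nonneg_of_mul_nonneg_right h4 (by linarith)]

theorem cliqueNum_pos [Nonempty V] (Γ : SimpleGraph V) : 0 < Γ.cliqueNum := by
  obtain ⟨v⟩ := ‹Nonempty V›
  have : Γ.IsClique (({v} : Finset V) : Set V) := by simp
  exact (Finset.card_pos.mpr ⟨v, by simp⟩).trans_le this.card_le_cliqueNum

end SimpleGraph

/-- A strongly regular graph with parameters `(ν, k, l, μ)`, `k ≥ 1`, not complete and `μ ≤ k`,
with smallest eigenvalue `s = (l − μ − √((l − μ)² + 4(k − μ)))/2`, is non-separating
(i.e. `ω(Γ)·α(Γ) = ν`) if and only if `ω(Γ) = 1 − k/s` and `α(Γ) = ν·s/(s − k)`. -/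
theorem nonseparating_iff_bounds_met {V : Type*} [Fintype V] (Γ : SimpleGraph V)
    [DecidableRel Γ.Adj]
    (ν k l μ : ℕ) (hsrg : Γ.IsSRGWith ν k l μ)
    (hk : 1 ≤ k) (hnc : ∃ u v : V, u ≠ v ∧ ¬Γ.Adj u v) (hμ : μ ≤ k)
    (s : ℝ)
    (hs : s = ((l : ℝ) - μ - Real.sqrt (((l : ℝ) - μ) ^ 2 + 4 * ((k : ℝ) - μ))) / 2) :
    Γ.cliqueNum * cocliqueNum Γ = ν ↔
      (Γ.cliqueNum : ℝ) = 1 - k / s ∧ (cocliqueNum Γ : ℝ) = ν * s / (s - k) := by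
  obtain ⟨u, -⟩ := hnc
  have : Nonempty V := ⟨u⟩
  have hn : 0 < (ν : ℝ) := by
    rw [← hsrg.card]
    exact_mod_cast Fintype.card_pos
  have hk' : (1 : ℝ) ≤ k := by exact_mod_cast hk
  have hμ' : (μ : ℝ) ≤ k := by exact_mod_cast hμ
  have hlk : (l : ℝ) < k := by exact_mod_cast hsrg.l_lt_k hk
  have hDnn : 0 ≤ ((l : ℝ) - μ) ^ 2 + 4 * ((k : ℝ) - μ) := by
    nlinarith [sq_nonneg ((l : ℝ) - μ)]
  set D := Real.sqrt (((l : ℝ) - μ) ^ 2 + 4 * ((k : ℝ) - μ)) with hD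
  have hDsq : D ^ 2 = ((l : ℝ) - μ) ^ 2 + 4 * ((k : ℝ) - μ) := Real.sq_sqrt hDnn
  have hD0 : 0 ≤ D := Real.sqrt_nonneg _
  obtain ⟨r, hr⟩ : ∃ r : ℝ, r = ((l : ℝ) - μ + D) / 2 := ⟨_, rfl⟩
  have hadd : r + s = (l : ℝ) - μ := by rw [hr, hs]; ring
  have hmul : r * s = (μ : ℝ) - k := by
    rw [hr, hs]
    linear_combination -hDsq / 4
  have habs : |(l : ℝ) - μ| ≤ D := abs_le_of_sq_le_sq (by linarith) hD0
  have hr0 : 0 ≤ r := by linarith [neg_abs_le ((l : ℝ) - μ)]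
  have hs0 : s < 0 := by
    refine lt_of_le_of_ne (by linarith [le_abs_self ((l : ℝ) - μ)]) fun h0 => ?_
    rw [h0] at hadd hmul
    linarith
  obtain ⟨C, hC⟩ := Γ.exists_isNClique_cliqueNum
  obtain ⟨I, hI⟩ := Γᶜ.exists_isNClique_cliqueNum
  have hω : 0 < (Γ.cliqueNum : ℝ) := by exact_mod_cast Γ.cliqueNum_pos
  have hα : 0 < (cocliqueNum Γ : ℝ) := by exact_mod_cast Γᶜ.cliqueNum_pos
  have hC' := hsrg.sub_le_card_mul_of_isClique hadd hmul hr0 hs0 hC.isClique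
    (Finset.card_pos.mp (hC.card_eq ▸ Γ.cliqueNum_pos))
  have hI' := hsrg.card_mul_le_of_isIndepSet hadd hmul (hs0.trans_le hr0)
    ((Γ.isClique_compl).mp hI.isClique) (Finset.card_pos.mp (hI.card_eq ▸ Γᶜ.cliqueNum_pos))
  rw [hC.card_eq] at hC'
  rw [hI.card_eq] at hI'
  change (cocliqueNum Γ : ℝ) * (k - s) ≤ _ at hI'
  have hsk : s - k < 0 := by linarith
  have hωle : (Γ.cliqueNum : ℝ) ≤ 1 - k / s := by
    rw [one_sub_div hs0.ne, le_div_iff_of_neg hs0]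
    exact hC'
  have hαle : (cocliqueNum Γ : ℝ) ≤ ν * s / (s - k) := by
    rw [le_div_iff_of_neg hsk]
    linarith
  have hprod : (1 - k / s) * (ν * s / (s - k)) = ν := by
    have := hs0.ne
    have := hsk.ne
    field_simp
  have hmain := mul_eq_mul_iff_eq_and_eq_of_pos hωle hαle hω (hα.trans_le hαle)
  rwa [hprod, ← Nat.cast_mul, Nat.cast_inj] at hmain
end

section
/- Let Γ be a strongly regular graph with parameters (ν, k, λ, μ) such that k ≥ 1 and Γ is not complete (there exist two distinct non-adjacent vertices), and with μ ≤ k. Let s = (λ − μ − √((λ − μ)² + 4(k − μ)))/2 be its smallest eigenvalue. If the real number k/s is not an integer, or the real number ν·s/(s − k) is not an integer, then Γ is separating, i.e., ω(Γ)·α(Γ) < ν. -/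
open SimpleGraph

namespace SimpleGraph

lemma sum_adj_mul_adj {V : Type*} [Fintype V] (Γ : SimpleGraph V) [DecidableRel Γ.Adj]
    (u w : V) :
    ∑ v, (if Γ.Adj v u then (1 : ℝ) else 0) * (if Γ.Adj v w then 1 else 0) =
      (Γ.adjMatrix ℝ * Γ.adjMatrix ℝ) u w := by
  simp only [Matrix.mul_apply, adjMatrix_apply, Γ.adj_comm u]

namespace IsSRGWith

variable {V : Type*} [Fintype V] {Γ : SimpleGraph V} [DecidableRel Γ.Adj] {ν k l μ : ℕ}

lemma sum_adj (h : Γ.IsSRGWith ν k l μ) (u : V) :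
    ∑ v, (if Γ.Adj v u then (1 : ℝ) else 0) = k := by
  simp_rw [Γ.adj_comm _ u]
  rw [Finset.sum_boole, ← h.regular u, ← card_neighborFinset_eq_degree,
    neighborFinset_eq_filter]

/-- The sum of squares of `A 1_S - p 1_S - q 1` is nonnegative, for `S` a set whose pairs of
distinct vertices have constant adjacency `ε` and constant number of common neighbours `t`. -/
lemma quadratic_nonneg (h : Γ.IsSRGWith ν k l μ) (S : Finset V) (ε t : ℝ)
    (hε : ∀ u ∈ S, ∀ w ∈ S, u ≠ w → (if Γ.Adj u w then (1 : ℝ) else 0) = ε)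
    (ht : ∀ u ∈ S, ∀ w ∈ S, u ≠ w → (Γ.adjMatrix ℝ * Γ.adjMatrix ℝ) u w = t) (p q : ℝ) :
    0 ≤ (k * S.card + t * S.card * (S.card - 1)) + p ^ 2 * S.card + ν * q ^ 2
      - 2 * p * ε * S.card * (S.card - 1) - 2 * q * k * S.card + 2 * p * q * S.card := by
  classical
  have pairs (f : V → V → ℝ) (d c : ℝ) (hd : ∀ u ∈ S, f u u = d)
      (hc : ∀ u ∈ S, ∀ w ∈ S, u ≠ w → f u w = c) :
      ∑ u ∈ S, ∑ w ∈ S, f u w = d * S.card + c * S.card * (S.card - 1) := by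
    have inner : ∀ u ∈ S, ∑ w ∈ S, f u w = d + c * (S.card - 1) := by
      intro u hu
      rw [← Finset.add_sum_erase S _ hu, hd u hu, Finset.sum_congr rfl
        (fun w hw ↦ hc u hu w (Finset.mem_of_mem_erase hw) (Finset.ne_of_mem_erase hw).symm),
        Finset.sum_const, nsmul_eq_mul, Finset.cast_card_erase_of_mem hu]
      ring
    rw [Finset.sum_congr rfl inner, Finset.sum_const, nsmul_eq_mul]
    ring
  set y : V → ℝ := fun v ↦ ∑ u ∈ S, if Γ.Adj v u then (1 : ℝ) else 0 with hy
  set x : V → ℝ := fun v ↦ if v ∈ S then (1 : ℝ) else 0 with hx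
  have sum_y : ∑ v, y v = k * S.card := by
    rw [hy, Finset.sum_comm, Finset.sum_congr rfl (fun u _ ↦ h.sum_adj u),
      Finset.sum_const, nsmul_eq_mul, mul_comm]
  have sum_yy : ∑ v, y v * y v = k * S.card + t * S.card * (S.card - 1) := by
    rw [← pairs (fun u w ↦ (Γ.adjMatrix ℝ * Γ.adjMatrix ℝ) u w) k t ?_ ht]
    · simp_rw [hy, Finset.sum_mul_sum, ← sum_adj_mul_adj]
      rw [Finset.sum_comm]
      exact Finset.sum_congr rfl fun u _ ↦ Finset.sum_comm
    · intro u _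
      rw [← sum_adj_mul_adj, ← h.sum_adj u]
      exact Finset.sum_congr rfl fun v _ ↦ by split_ifs <;> simp
  have sum_xy : ∑ v, x v * y v = ε * S.card * (S.card - 1) := by
    have := pairs (fun u w ↦ if Γ.Adj u w then (1 : ℝ) else 0) 0 ε (by simp) hε
    simp only [hx, ite_mul, one_mul, zero_mul, Finset.sum_ite_mem, Finset.univ_inter, hy]
    linarith
  have sum_x : ∑ v, x v = S.card := by simp [hx]
  have sum_xx : ∑ v, x v * x v = S.card := by simp [hx]
  have sq : 0 ≤ ∑ v, (y v - p * x v - q) ^ 2 := Finset.sum_nonneg fun v _ ↦ sq_nonneg _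
  have expand : ∑ v, (y v - p * x v - q) ^ 2 = ∑ v, y v * y v + p ^ 2 * ∑ v, x v * x v
      + ν * q ^ 2 - 2 * p * ∑ v, x v * y v - 2 * q * ∑ v, y v + 2 * p * q * ∑ v, x v := by
    have hν : (ν : ℝ) * q ^ 2 = ∑ _v : V, q ^ 2 := by simp [h.card]
    rw [hν]
    simp only [Finset.mul_sum, ← Finset.sum_add_distrib, ← Finset.sum_sub_distrib]
    exact Finset.sum_congr rfl fun v _ ↦ by ring
  rw [expand, sum_yy, sum_xx, sum_xy, sum_y, sum_x] at sq
  linarith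

lemma quadratic_nonneg_of_isClique (h : Γ.IsSRGWith ν k l μ) {S : Finset V}
    (hS : Γ.IsClique S) (p q : ℝ) :
    0 ≤ (k * S.card + l * S.card * (S.card - 1)) + p ^ 2 * S.card + ν * q ^ 2
      - 2 * p * S.card * (S.card - 1) - 2 * q * k * S.card + 2 * p * q * S.card := by
  classical
  have := h.quadratic_nonneg S 1 l (fun u hu w hw huw ↦ if_pos (hS hu hw huw))
    (fun u hu w hw huw ↦ by
      rw [← pow_two, h.matrix_eq]
      simp only [Matrix.add_apply, Matrix.smul_apply, Matrix.one_apply_ne huw]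
      simp [hS hu hw huw, huw]) p q
  linarith

lemma quadratic_nonneg_of_isIndepSet (h : Γ.IsSRGWith ν k l μ) {S : Finset V}
    (hS : Γ.IsIndepSet S) (p q : ℝ) :
    0 ≤ (k * S.card + μ * S.card * (S.card - 1)) + p ^ 2 * S.card + ν * q ^ 2
      - 2 * q * k * S.card + 2 * p * q * S.card := by
  classical
  have := h.quadratic_nonneg S 0 μ (fun u hu w hw huw ↦ if_neg (hS hu hw huw))
    (fun u hu w hw huw ↦ by
      rw [← pow_two, h.matrix_eq]
      simp only [Matrix.add_apply, Matrix.smul_apply, Matrix.one_apply_ne huw]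
      simp [hS hu hw huw, huw]) p q
  linarith

variable {r s : ℝ}

/-- Hoffman's bound for cocliques, in terms of the restricted eigenvalues `s < r`. -/
lemma card_le_of_isIndepSet (h : Γ.IsSRGWith ν k l μ) (hν : 0 < ν) (hsr : s < r) (hs : s < 0)
    (hmul : r * s = μ - k) (hpar : (k - r) * (k - s) = μ * ν)
    {S : Finset V} (hS : Γ.IsIndepSet S) :
    (S.card : ℝ) ≤ ν * s / (s - k) := by
  have hν' : (0 : ℝ) < ν := by exact_mod_cast hν
  have hk : (0 : ℝ) ≤ k := k.cast_nonneg
  rcases S.eq_empty_or_nonempty with rfl | hne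
  · rw [Finset.card_empty, Nat.cast_zero]
    exact div_nonneg_of_nonpos (mul_nonpos_of_nonneg_of_nonpos hν'.le hs.le) (by linarith)
  have ha : (0 : ℝ) < S.card := by exact_mod_cast hne.card_pos
  set a : ℝ := (S.card : ℝ)
  have key := mul_nonneg hν'.le (h.quadratic_nonneg_of_isIndepSet hS s ((k - s) * a / ν))
  have factor : ν * ((k * a + μ * a * (a - 1)) + s ^ 2 * a + ν * ((k - s) * a / ν) ^ 2
      - 2 * ((k - s) * a / ν) * k * a + 2 * s * ((k - s) * a / ν) * a) =
      ((r - s) * a) * (-s * ν - (k - s) * a) := by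
    field_simp
    linear_combination ν * hmul - a * hpar
  rw [factor] at key
  have := nonneg_of_mul_nonneg_right key (mul_pos (sub_pos.2 hsr) ha)
  rw [le_div_iff_of_neg (by linarith)]
  linarith

/-- The Delsarte bound for cliques, in terms of the restricted eigenvalues `s < r`. -/
lemma card_le_of_isClique (h : Γ.IsSRGWith ν k l μ) (hkν : k < ν) (hr : 0 ≤ r) (hs : s < 0)
    (hadd : r + s = l - μ) (hmul : r * s = μ - k) (hpar : (k - r) * (k - s) = μ * ν)
    {S : Finset V} (hS : Γ.IsClique S) :
    (S.card : ℝ) ≤ 1 - k / s := by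
  have hkν' : (k : ℝ) < ν := by exact_mod_cast hkν
  have hk : (0 : ℝ) ≤ k := k.cast_nonneg
  have hν' : (0 : ℝ) < ν := hk.trans_lt hkν'
  rcases S.eq_empty_or_nonempty with rfl | hne
  · rw [Finset.card_empty, Nat.cast_zero]
    linarith [div_nonpos_of_nonneg_of_nonpos hk hs.le]
  have ha : (0 : ℝ) < S.card := by exact_mod_cast hne.card_pos
  set a : ℝ := (S.card : ℝ)
  have key := mul_nonneg hν'.le (h.quadratic_nonneg_of_isClique hS r ((k - r) * a / ν))
  have factor : ν * ((k * a + l * a * (a - 1)) + r ^ 2 * a + ν * ((k - r) * a / ν) ^ 2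
      - 2 * r * a * (a - 1) - 2 * ((k - r) * a / ν) * k * a + 2 * r * ((k - r) * a / ν) * a) =
      ((r - s) * a) * (ν * (r - a + 1) + (k - r) * a) := by
    field_simp
    linear_combination ν * hmul + ν * (1 - a) * hadd - a * hpar
  rw [factor] at key
  have bound := nonneg_of_mul_nonneg_right key (mul_pos (by linarith) ha)
  have hpos : (0 : ℝ) < ν - k + r := by linarith
  have : 0 ≤ (ν - k + r) * (a * s - (s - k)) := by
    have := mul_nonneg bound (neg_nonneg.2 hs.le)
    linear_combination this - ν * hmul + hpar
  have := nonneg_of_mul_nonneg_right this hpos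
  rw [one_sub_div hs.ne, le_div_iff_of_neg hs]
  linarith

/-- The integer parameters satisfy `k (k - l - 1) = (ν - k - 1) μ`, without truncation. -/
lemma cast_param_eq (h : Γ.IsSRGWith ν k l μ) (hlk : l < k) (hkν : k < ν) :
    (k : ℝ) * (k - l - 1) = (ν - k - 1) * μ := by
  have := h.param_eq Γ (by omega)
  obtain ⟨c, rfl⟩ := Nat.exists_eq_add_of_lt hlk
  obtain ⟨d, rfl⟩ := Nat.exists_eq_add_of_lt hkν
  have e₁ : l + c + 1 - l - 1 = c := by omega
  have e₂ : l + c + 1 + d + 1 - (l + c + 1) - 1 = d := by omega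
  rw [e₁, e₂] at this
  have : ((l + c + 1 : ℕ) : ℝ) * c = d * μ := by exact_mod_cast this
  push_cast at this ⊢
  linear_combination this

end IsSRGWith

end SimpleGraph

/-- If, for a strongly regular graph `Γ` with parameters `(ν, k, l, μ)`, `k ≥ 1`, not complete
and `μ ≤ k`, with smallest eigenvalue `s = (l − μ − √((l − μ)² + 4(k − μ)))/2`, either `k/s`
or `ν·s/(s − k)` is not an integer, then `Γ` is separating: `ω(Γ)·α(Γ) < ν`. -/
theorem separating_of_not_integral {V : Type*} [Fintype V] (Γ : SimpleGraph V)
    [DecidableRel Γ.Adj]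
    (ν k l μ : ℕ) (hsrg : Γ.IsSRGWith ν k l μ)
    (hk : 1 ≤ k) (hnc : ∃ u v : V, u ≠ v ∧ ¬Γ.Adj u v) (hμ : μ ≤ k)
    (s : ℝ)
    (hs : s = ((l : ℝ) - μ - Real.sqrt (((l : ℝ) - μ) ^ 2 + 4 * ((k : ℝ) - μ))) / 2)
    (hint : (¬ ∃ z : ℤ, (k : ℝ) / s = z) ∨ (¬ ∃ z : ℤ, (ν : ℝ) * s / (s - k) = z)) :
    Γ.cliqueNum * cocliqueNum Γ < ν := by
  obtain ⟨u₀, -, -⟩ := hnc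
  have hdeg := hsrg.regular u₀
  have hkν : k < ν := by
    rw [← hdeg, ← hsrg.card]
    exact Γ.degree_lt_card_verts u₀
  have hlk : l < k := by
    obtain ⟨w, hw⟩ := (Γ.degree_pos_iff_exists_adj u₀).1 (hdeg.symm ▸ hk)
    rw [← hsrg.of_adj u₀ w hw, ← hdeg]
    exact hw.card_commonNeighbors_lt_degree
  have hkν' : (k : ℝ) < ν := by exact_mod_cast hkν
  have hlk' : (l : ℝ) < k := by exact_mod_cast hlk
  have hμ' : (μ : ℝ) ≤ k := by exact_mod_cast hμ
  have hk' : (0 : ℝ) < k := by exact_mod_cast hk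
  have hν' : (0 : ℝ) < ν := hk'.trans hkν'
  have hpar := hsrg.cast_param_eq hlk hkν
  set D := Real.sqrt (((l : ℝ) - μ) ^ 2 + 4 * ((k : ℝ) - μ)) with hD
  have hD0 : 0 ≤ D := Real.sqrt_nonneg _
  have hDsq : D ^ 2 = ((l : ℝ) - μ) ^ 2 + 4 * ((k : ℝ) - μ) :=
    Real.sq_sqrt (by nlinarith [sq_nonneg ((l : ℝ) - μ)])
  obtain ⟨r, hr⟩ : ∃ r : ℝ, r = ((l : ℝ) - μ + D) / 2 := ⟨_, rfl⟩
  have hadd : r + s = l - μ := by rw [hr, hs]; ring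
  have hmul : r * s = μ - k := by rw [hr, hs]; linear_combination (-1 / 4) * hDsq
  have hr0 : 0 ≤ r := by
    have := (abs_le_of_sq_le_sq' (by linarith : ((l : ℝ) - μ) ^ 2 ≤ D ^ 2) hD0).1
    linarith
  have hs0 : s < 0 := by
    have : (l : ℝ) - μ < D := by
      by_contra! hle
      nlinarith
    linarith
  have hprod : ((k : ℝ) - r) * (k - s) = μ * ν := by
    linear_combination hpar - k * hadd + hmul
  obtain ⟨C, hC⟩ := Γ.exists_isNClique_cliqueNum
  obtain ⟨I, hI⟩ := Γᶜ.exists_isNClique_cliqueNum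
  have hω := hsrg.card_le_of_isClique hkν hr0 hs0 hadd hmul hprod hC.isClique
  have hα := hsrg.card_le_of_isIndepSet (by omega) (hs0.trans_le hr0) hs0 hmul hprod
    ((isClique_compl Γ).1 hI.isClique)
  rw [hC.card_eq] at hω
  rw [hI.card_eq] at hα
  change (cocliqueNum Γ : ℝ) ≤ _ at hα
  have hsk : s - k < 0 := by linarith
  have hW : 0 < 1 - k / s := by linarith [div_neg_of_pos_of_neg hk' hs0]
  have hB : 0 < ν * s / (s - k) := div_pos_of_neg_of_neg (mul_neg_of_pos_of_neg hν' hs0) hsk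
  have hWB : (1 - k / s) * (ν * s / (s - k)) = ν := by
    have := hs0.ne
    have := hsk.ne
    field_simp
  by_contra! hge
  have hge' : (ν : ℝ) ≤ Γ.cliqueNum * cocliqueNum Γ := by exact_mod_cast hge
  have hω_eq : (Γ.cliqueNum : ℝ) = 1 - k / s := by
    refine hω.antisymm (le_of_mul_le_mul_right ?_ hB)
    rw [hWB]
    exact hge'.trans (mul_le_mul_of_nonneg_left hα (Nat.cast_nonneg _))
  have hα_eq : (cocliqueNum Γ : ℝ) = ν * s / (s - k) := by
    refine hα.antisymm (le_of_mul_le_mul_left ?_ hW)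
    rw [hWB]
    exact hge'.trans (mul_le_mul_of_nonneg_right hω (Nat.cast_nonneg _))
  rcases hint with hint | hint
  · exact hint ⟨1 - Γ.cliqueNum, by push_cast; linarith⟩
  · exact hint ⟨cocliqueNum Γ, by push_cast; linarith⟩
end

section
/- (Neumann's separation theorem) Let G be a group acting transitively on a finite set Ω, and let A and B be subsets of Ω with |A|·|B| < |Ω|. Then there exists g ∈ G such that the translate g·A is disjoint from B, i.e., for all a ∈ A, g·a ∉ B. -/
/-- **Neumann's separation theorem**: if a group `G` acts transitively on a finite set `Ω`
and `A`, `B` are subsets of `Ω` with `|A|·|B| < |Ω|`, then some `g ∈ G` separates them: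
the translate `g • A` is disjoint from `B`. -/
theorem neumann_separation {G : Type*} [Group G] {Ω : Type*} [Fintype Ω] [MulAction G Ω]
    (htrans : ∀ x y : Ω, ∃ g : G, g • x = y)
    (A B : Finset Ω) (hcard : A.card * B.card < Fintype.card Ω) :
    ∃ g : G, ∀ a ∈ A, g • a ∉ B := by
  by_contra! h
  have : MulAction.IsPretransitive G Ω := ⟨htrans⟩
  choose t ht using htrans
  open scoped Pointwise in
  have hcover : ⋃ p ∈ A ×ˢ B, t p.1 p.2 • (MulAction.stabilizer G p.1 : Set G) = Set.univ := by
    refine Set.eq_univ_of_forall fun g ↦ ?_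
    obtain ⟨a, ha, hb⟩ := h g
    refine Set.mem_biUnion (x := (a, g • a)) (Finset.mem_product.2 ⟨ha, hb⟩) ?_
    rw [mem_leftCoset_iff, SetLike.mem_coe, MulAction.mem_stabilizer_iff, mul_smul,
      inv_smul_eq_iff, ht]
  obtain ⟨p, -, -, hp⟩ := Subgroup.exists_index_le_card_of_leftCoset_cover hcover
  rw [MulAction.index_stabilizer_of_transitive, Nat.card_eq_fintype_card,
    Finset.card_product] at hp
  exact hcard.not_ge hp
end

section
/- Let q ≥ 4 be an even natural number and m ≥ 2 a natural number. Then q^m − 2q^{m−1} + 1 does not divide 2q^{m−1}·(q^{m−1} − 1). -/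
/-- For an even natural number `q ≥ 4` and `m ≥ 2`, `q^m − 2q^(m−1) + 1` does not divide
`2q^(m−1)·(q^(m−1) − 1)`. -/
theorem not_dvd_NO_minus (q m : ℕ) (hq : 4 ≤ q) (hqe : Even q) (hm : 2 ≤ m) :
    ¬ (q ^ m - 2 * q ^ (m - 1) + 1 ∣ 2 * q ^ (m - 1) * (q ^ (m - 1) - 1)) := by
  obtain ⟨r, rfl⟩ : ∃ r, q = 2 * r + 2 := by
    obtain ⟨k, rfl⟩ := hqe
    exact ⟨k - 1, by omega⟩
  have hr : 1 ≤ r := by omega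
  have hx : 1 < (2 * r + 2) ^ (m - 1) := Nat.one_lt_pow (by omega) (by omega)
  have hpow : (2 * r + 2) ^ m = (2 * r + 2) ^ (m - 1) * (2 * r + 2) :=
    (pow_sub_one_mul (by omega) _).symm
  rw [hpow]
  generalize (2 * r + 2) ^ (m - 1) = x at hx
  have hN : x * (2 * r + 2) - 2 * x + 1 = 2 * x * r + 1 := by
    rw [show x * (2 * r + 2) = 2 * x * r + 2 * x by ring, Nat.add_sub_cancel]
  rw [hN]
  intro h
  have hcop : Nat.Coprime (2 * x * r + 1) (2 * x) := by simp
  have hle := Nat.le_of_dvd (by omega) (hcop.dvd_of_dvd_mul_left h)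
  have := Nat.le_mul_of_pos_right (2 * x) hr
  omega
end

section
/- Let e be an odd prime, p a prime whose image in ℤ/eℤ has multiplicative order e − 1, and t an odd positive natural number. Let F be a finite field with |F| = p^{(e−1)·t}. Then every nonzero element x ∈ F satisfying x^{p^{((e−1)·t)/2}} = x (i.e., every nonzero element of the subfield of order p^{((e−1)·t)/2}) is an e-th power in F: there exists y ∈ F with y^e = x. -/
/-- Let `e` be an odd prime, `p` a prime that is a primitive root modulo `e`, and `t` an odd
positive natural number. In a finite field `F` with `p^((e−1)·t)` elements, every nonzero
element of the subfield of order `p^(((e−1)·t)/2)` (i.e. every nonzero `x` with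
`x^(p^(((e−1)·t)/2)) = x`) is an `e`-th power in `F`. -/
theorem subfield_elements_are_eth_powers (e p t : ℕ) (he : e.Prime) (heodd : Odd e)
    (hp : p.Prime) (horder : orderOf (p : ZMod e) = e - 1) (ht : Odd t) (htpos : 0 < t)
    {F : Type*} [Field F] [Fintype F] (hcard : Fintype.card F = p ^ ((e - 1) * t))
    (x : F) (hx : x ≠ 0) (hsub : x ^ (p ^ ((e - 1) * t / 2)) = x) :
    ∃ y : F, y ^ e = x := by
  obtain ⟨m, hm⟩ := heodd
  have hm0 : 0 < m := by
    have := he.two_le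
    omega
  have he1 : e - 1 = 2 * m := by omega
  have hhalf : (e - 1) * t / 2 = m * t := by
    rw [he1, mul_assoc, Nat.mul_div_cancel_left _ two_pos]
  rw [hhalf] at hsub
  have hpos : 1 ≤ p ^ (m * t) := Nat.one_le_pow _ _ hp.pos
  have hndvd : ¬ e ∣ p ^ (m * t) - 1 := by
    intro h
    have hone : (p : ZMod e) ^ (m * t) = 1 := by
      have := (ZMod.natCast_eq_zero_iff _ _).2 h
      rw [Nat.cast_sub hpos, sub_eq_zero] at this
      exact_mod_cast this
    have hdvd := orderOf_dvd_of_pow_eq_one hone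
    rw [horder, he1, mul_comm 2 m] at hdvd
    exact ht.not_two_dvd_nat (Nat.dvd_of_mul_dvd_mul_left hm0 hdvd)
  have hord : orderOf x ∣ p ^ (m * t) - 1 := by
    apply orderOf_dvd_of_pow_eq_one
    apply mul_right_cancel₀ hx
    rw [← pow_succ, Nat.sub_add_cancel hpos, hsub, one_mul]
  have hcop : e.Coprime (orderOf x) :=
    ((he.coprime_iff_not_dvd).2 hndvd).coprime_dvd_right hord
  obtain ⟨k, hk⟩ := exists_pow_eq_self_of_coprime hcop
  exact ⟨x ^ k, by rw [← pow_mul, mul_comm, pow_mul, hk]⟩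
end
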